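/- Let λ_1,…,λ_n ≥ 0 and let φ_1,…,φ_n : ℝ^d → ℂ be twice continuously differentiable on a neighborhood of a point x₀ ∈ ℝ^d with ρ(x₀) > 0. Then |∇√ρ(x₀)|² + |j(x₀)|²/ρ(x₀) + (1/√d) ρ(x₀) |D_a(j/ρ)(x₀)| ≤ τ(x₀), where |D_a(j/ρ)(x₀)| denotes the Frobenius norm of the antisymmetric part of the Jacobian of the vector field j/ρ (defined on the open set where ρ > 0), and |∇√ρ(x₀)|² = |∇ρ(x₀)|²/(4ρ(x₀)). -/

import Mathlib

open MeasureTheory Complex Finset Matrix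

/-- Partial derivative of a complex-valued function on `ℝ^d` in the `i`-th
coordinate direction. -/
noncomputable def pderivC {d : ℕ} (f : EuclideanSpace ℝ (Fin d) → ℂ)
    (x : EuclideanSpace ℝ (Fin d)) (i : Fin d) : ℂ :=
  fderiv ℝ f x (EuclideanSpace.single i 1)

/-- Partial derivative of a real-valued function on `ℝ^d` in the `i`-th
coordinate direction. -/
noncomputable def pderivR {d : ℕ} (f : EuclideanSpace ℝ (Fin d) → ℝ)
    (x : EuclideanSpace ℝ (Fin d)) (i : Fin d) : ℝ :=
  fderiv ℝ f x (EuclideanSpace.single i 1)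

theorem weighted_gram_im_sq_le {n : ℕ} (lam : Fin n → ℝ) (hlam : ∀ j, 0 ≤ lam j)
    (u v : Fin n → ℂ) :
    (∑ j, (lam j : ℂ) * u j * (starRingEnd ℂ) (v j)).im ^ 2
      ≤ (∑ j, lam j * ‖u j‖ ^ 2) * ∑ j, lam j * ‖v j‖ ^ 2 := by
  have h1 : |(∑ j, (lam j : ℂ) * u j * (starRingEnd ℂ) (v j)).im|
      ≤ ∑ j, lam j * (‖u j‖ * ‖v j‖) := by
    refine (Complex.abs_im_le_norm _).trans ((norm_sum_le _ _).trans (le_of_eq ?_))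
    refine Finset.sum_congr rfl fun j _ => ?_
    rw [norm_mul, norm_mul, RCLike.norm_conj, Complex.norm_real, Real.norm_of_nonneg (hlam j),
      mul_assoc]
  calc _ = |(∑ j, (lam j : ℂ) * u j * (starRingEnd ℂ) (v j)).im| ^ 2 := (sq_abs _).symm
    _ ≤ (∑ j, lam j * (‖u j‖ * ‖v j‖)) ^ 2 := by gcongr
    _ ≤ _ := Finset.sum_sq_le_sum_mul_sum_of_sq_le_mul _
      (fun j _ => mul_nonneg (hlam j) (sq_nonneg _))
      (fun j _ => mul_nonneg (hlam j) (sq_nonneg _)) (fun j _ => le_of_eq (by ring))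

/-- The weighted Gram entry of two families after projecting out a third family `f`. -/
theorem weighted_gram_sub_proj {n : ℕ} (lam : Fin n → ℝ) (f u v : Fin n → ℂ) (r : ℝ)
    (hr : r = ∑ j, lam j * ‖f j‖ ^ 2) (hr0 : r ≠ 0) (a b : ℂ)
    (ha : a = ∑ j, (lam j : ℂ) * u j * (starRingEnd ℂ) (f j))
    (hb : b = ∑ j, (lam j : ℂ) * v j * (starRingEnd ℂ) (f j)) :
    ∑ j, (lam j : ℂ) * (u j - a / r * f j) * (starRingEnd ℂ) (v j - b / r * f j)
      = ∑ j, (lam j : ℂ) * u j * (starRingEnd ℂ) (v j) - a * (starRingEnd ℂ) b / r := by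
  have hrC : (r : ℂ) = ∑ j, (lam j : ℂ) * f j * (starRingEnd ℂ) (f j) := by
    rw [hr]
    push_cast
    exact Finset.sum_congr rfl fun j _ => by rw [mul_assoc, Complex.mul_conj']
  have hb' : (starRingEnd ℂ) b = ∑ j, (lam j : ℂ) * f j * (starRingEnd ℂ) (v j) := by
    rw [hb, map_sum]
    refine Finset.sum_congr rfl fun j _ => ?_
    simp only [map_mul, Complex.conj_ofReal, Complex.conj_conj]
    ring
  have hr1 : (r : ℂ) ≠ 0 := by exact_mod_cast hr0
  have key : ∑ j, (lam j : ℂ) * (u j - a / r * f j) * (starRingEnd ℂ) (v j - b / r * f j)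
      = ∑ j, (lam j : ℂ) * u j * (starRingEnd ℂ) (v j)
        - (starRingEnd ℂ) b / r * (∑ j, (lam j : ℂ) * u j * (starRingEnd ℂ) (f j))
        - a / r * (∑ j, (lam j : ℂ) * f j * (starRingEnd ℂ) (v j))
        + a / r * ((starRingEnd ℂ) b / r)
          * (∑ j, (lam j : ℂ) * f j * (starRingEnd ℂ) (f j)) := by
    simp only [Finset.mul_sum, ← Finset.sum_sub_distrib, ← Finset.sum_add_distrib]
    refine Finset.sum_congr rfl fun j _ => ?_
    simp only [map_sub, map_mul, map_div₀, Complex.conj_ofReal]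
    ring
  rw [key, ← ha, ← hb', ← hrC]
  field_simp
  ring

theorem weighted_norm_sq_sub_proj {n : ℕ} (lam : Fin n → ℝ) (f u : Fin n → ℂ) (r : ℝ)
    (hr : r = ∑ j, lam j * ‖f j‖ ^ 2) (hr0 : r ≠ 0) (a : ℂ)
    (ha : a = ∑ j, (lam j : ℂ) * u j * (starRingEnd ℂ) (f j)) :
    ∑ j, lam j * ‖u j - a / r * f j‖ ^ 2
      = ∑ j, lam j * ‖u j‖ ^ 2 - (a.re ^ 2 + a.im ^ 2) / r := by
  have h := weighted_gram_sub_proj lam f u u r hr hr0 a a ha ha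
  simp only [mul_assoc, Complex.mul_conj'] at h
  have h2 : a.re ^ 2 + a.im ^ 2 = ‖a‖ ^ 2 := by
    rw [← Complex.normSq_eq_norm_sq, Complex.normSq_apply]; ring
  rw [h2]
  exact_mod_cast h

theorem sqrt_sum_sq_le_sum_of_sq_le_mul {d : ℕ} (B : Fin d → Fin d → ℝ) (T : Fin d → ℝ)
    (hT : ∀ i, 0 ≤ T i) (h : ∀ i k, B i k ^ 2 ≤ T i * T k) :
    √(∑ i, ∑ k, B i k ^ 2) ≤ ∑ i, T i := by
  refine Real.sqrt_le_iff.2 ⟨Finset.sum_nonneg fun i _ => hT i, ?_⟩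
  rw [sq, Finset.sum_mul_sum]
  exact Finset.sum_le_sum fun i _ => Finset.sum_le_sum fun k _ => h i k

theorem Matrix.div_two_apply {d : ℕ} (A : Matrix (Fin d) (Fin d) ℝ) (i k : Fin d) :
    (A / 2) i k = A i k / 2 := by
  have h2 : (2 : Matrix (Fin d) (Fin d) ℝ)⁻¹ = (1 / 2 : ℝ) • 1 := by
    refine Matrix.inv_eq_right_inv ?_
    rw [mul_smul_comm, mul_one]
    ext i k
    rw [Matrix.smul_apply, ← Matrix.diagonal_ofNat, Matrix.diagonal_apply, Matrix.one_apply]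
    split_ifs <;> simp
  rw [div_eq_mul_inv, h2, mul_smul_comm, mul_one, Matrix.smul_apply, smul_eq_mul]
  ring

theorem hasFDerivAt_pderivC {d : ℕ} {f : EuclideanSpace ℝ (Fin d) → ℂ}
    {x : EuclideanSpace ℝ (Fin d)} (hf : ContDiffAt ℝ 2 f x) (i : Fin d) :
    HasFDerivAt (fun y => pderivC f y i)
      ((fderiv ℝ (fderiv ℝ f) x).flip (EuclideanSpace.single i 1)) x := by
  have h : HasFDerivAt (fderiv ℝ f) (fderiv ℝ (fderiv ℝ f) x) x :=
    ((hf.fderiv_right (m := 1) (by norm_num)).differentiableAt (by norm_num)).hasFDerivAt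
  exact h.clm_apply (hasFDerivAt_const _ _) |>.congr_fderiv (by ext; simp)

theorem fderiv_fderiv_single_comm {d : ℕ} {f : EuclideanSpace ℝ (Fin d) → ℂ}
    {x : EuclideanSpace ℝ (Fin d)} (hf : ContDiffAt ℝ 2 f x) (i k : Fin d) :
    fderiv ℝ (fderiv ℝ f) x (EuclideanSpace.single i 1) (EuclideanSpace.single k 1)
      = fderiv ℝ (fderiv ℝ f) x (EuclideanSpace.single k 1) (EuclideanSpace.single i 1) :=
  (hf.isSymmSndFDerivAt (by simp)).eq _ _

/-- The weighted sum of products `f j * conj (g j)` has the expected derivative. -/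
theorem hasFDerivAt_sum_mul_conj {E : Type*} [NormedAddCommGroup E] [NormedSpace ℝ E] {n : ℕ}
    (lam : Fin n → ℝ) {f g : Fin n → E → ℂ} {f' g' : Fin n → E →L[ℝ] ℂ} {x : E}
    (hf : ∀ j, HasFDerivAt (f j) (f' j) x) (hg : ∀ j, HasFDerivAt (g j) (g' j) x) :
    ∃ L : E →L[ℝ] ℂ,
      HasFDerivAt (fun y => ∑ j, (lam j : ℂ) * f j y * (starRingEnd ℂ) (g j y)) L x ∧
      ∀ v, L v = ∑ j, (lam j : ℂ) *
        (f' j v * (starRingEnd ℂ) (g j x) + f j x * (starRingEnd ℂ) (g' j v)) := by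
  have hc : ∀ j, HasFDerivAt (fun y => (starRingEnd ℂ) (g j y))
      ((Complex.conjCLE : ℂ →L[ℝ] ℂ).comp (g' j)) x := fun j =>
    (Complex.conjCLE : ℂ →L[ℝ] ℂ).hasFDerivAt.comp x (hg j)
  refine ⟨_, HasFDerivAt.fun_sum fun j _ => ((hf j).const_mul (lam j : ℂ)).mul (hc j), ?_⟩
  intro v
  rw [_root_.sum_apply]
  refine Finset.sum_congr rfl fun j _ => ?_
  simp
  ring

theorem stmt4 {d n : ℕ} (lam : Fin n → ℝ) (hlam : ∀ j, 0 ≤ lam j)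
    (φ : Fin n → EuclideanSpace ℝ (Fin d) → ℂ) (x₀ : EuclideanSpace ℝ (Fin d))
    (hφ : ∀ j, ContDiffAt ℝ 2 (φ j) x₀)
    -- density ρ
    (ρ : EuclideanSpace ℝ (Fin d) → ℝ) (hρ : ρ = fun x => ∑ j, lam j * ‖φ j x‖ ^ 2)
    (hρpos : 0 < ρ x₀)
    -- paramagnetic current density j
    (jp : EuclideanSpace ℝ (Fin d) → Fin d → ℝ)
    (hjp : jp = fun x i =>
      (∑ j, (lam j : ℂ) * pderivC (φ j) x i * (starRingEnd ℂ) (φ j x)).im)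
    -- kinetic energy density τ(x₀)
    (τ : ℝ) (hτ : τ = ∑ j, lam j * ∑ i, ‖pderivC (φ j) x₀ i‖ ^ 2)
    -- antisymmetric part of the Jacobian of j/ρ at x₀
    (Da : Matrix (Fin d) (Fin d) ℝ)
    (hDa : Da = ((Matrix.of fun i k => pderivR (fun x => jp x i / ρ x) x₀ k)
      - (Matrix.of fun i k => pderivR (fun x => jp x i / ρ x) x₀ k)ᵀ) / 2) :
    (∑ i, pderivR ρ x₀ i ^ 2) / (4 * ρ x₀) + (∑ i, jp x₀ i ^ 2) / ρ x₀
      + (1 / Real.sqrt d) * ρ x₀ * Real.sqrt (∑ i, ∑ k, Da i k ^ 2) ≤ τ := by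
  set z : EuclideanSpace ℝ (Fin d) → Fin d → ℂ := fun x i =>
    ∑ j, (lam j : ℂ) * pderivC (φ j) x i * (starRingEnd ℂ) (φ j x) with hz
  have hjz : ∀ x i, jp x i = (z x i).im := fun x i => by rw [hjp]
  have hρx : ρ x₀ = ∑ j, lam j * ‖φ j x₀‖ ^ 2 := by rw [hρ]
  have hφ' : ∀ j, HasFDerivAt (φ j) (fderiv ℝ (φ j) x₀) x₀ := fun j =>
    ((hφ j).differentiableAt (by norm_num)).hasFDerivAt
  obtain ⟨R, hR, hRv⟩ := hasFDerivAt_sum_mul_conj lam hφ' hφ'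
  have hρre : ρ = fun x => (∑ j, (lam j : ℂ) * φ j x * (starRingEnd ℂ) (φ j x)).re := by
    rw [hρ]
    funext x
    rw [Complex.re_sum]
    refine Finset.sum_congr rfl fun j _ => ?_
    rw [mul_assoc, Complex.mul_conj']
    norm_cast
  have hρ' : HasFDerivAt ρ (Complex.reCLM.comp R) x₀ := by
    rw [hρre]
    exact Complex.reCLM.hasFDerivAt.comp x₀ hR
  have hpρ : ∀ i, Complex.reCLM.comp R (EuclideanSpace.single i 1) = 2 * (z x₀ i).re := by
    intro i
    rw [ContinuousLinearMap.comp_apply, Complex.reCLM_apply, hRv, hz, Complex.re_sum,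
      Complex.re_sum, Finset.mul_sum]
    refine Finset.sum_congr rfl fun j _ => ?_
    simp [pderivC]
    ring
  choose Z hZ hZv using fun i => hasFDerivAt_sum_mul_conj lam
    (fun j => hasFDerivAt_pderivC (hφ j) i) hφ'
  have hq : ∀ i k, pderivR (fun x => jp x i / ρ x) x₀ k
      = (Z i (EuclideanSpace.single k 1)).im / ρ x₀
        - (z x₀ i).im * (2 * (z x₀ k).re) / ρ x₀ ^ 2 := by
    intro i k
    have hj' : HasFDerivAt (fun x => jp x i) (Complex.imCLM.comp (Z i)) x₀ := by
      rw [hjp]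
      exact Complex.imCLM.hasFDerivAt.comp x₀ (hZ i)
    have hinv : HasFDerivAt (fun x => (ρ x)⁻¹)
        ((-(ρ x₀ ^ 2)⁻¹) • Complex.reCLM.comp R) x₀ :=
      (hasDerivAt_inv hρpos.ne').comp_hasFDerivAt x₀ hρ'
    simp only [div_eq_mul_inv]
    rw [pderivR, (hj'.fun_mul hinv).fderiv]
    have h := hpρ k
    simp only [ContinuousLinearMap.comp_apply, Complex.reCLM_apply] at h
    simp [h, hjz]
    ring
  set w : Fin d → Fin n → ℂ := fun i j =>
    pderivC (φ j) x₀ i - z x₀ i / ρ x₀ * φ j x₀ with hw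
  have hDaw : ∀ i k, ρ x₀ * Da i k
      = (∑ j, (lam j : ℂ) * w i j * (starRingEnd ℂ) (w k j)).im := by
    intro i k
    have hcurl : (Z i (EuclideanSpace.single k 1)).im - (Z k (EuclideanSpace.single i 1)).im
        = 2 * (∑ j, (lam j : ℂ) * pderivC (φ j) x₀ i
          * (starRingEnd ℂ) (pderivC (φ j) x₀ k)).im := by
      rw [hZv, hZv, Complex.im_sum, Complex.im_sum, Complex.im_sum, Finset.mul_sum,
        ← Finset.sum_sub_distrib]
      refine Finset.sum_congr rfl fun j _ => ?_
      simp only [ContinuousLinearMap.flip_apply]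
      rw [fderiv_fderiv_single_comm (hφ j) i k]
      simp [pderivC]
      ring
    have hg := weighted_gram_sub_proj lam (fun j => φ j x₀) (fun j => pderivC (φ j) x₀ i)
      (fun j => pderivC (φ j) x₀ k) (ρ x₀) hρx hρpos.ne' (z x₀ i) (z x₀ k) rfl rfl
    rw [hg, hDa, Matrix.div_two_apply, Matrix.sub_apply, Matrix.transpose_apply,
      Matrix.of_apply, Matrix.of_apply, hq, hq, Complex.sub_im, Complex.div_ofReal_im,
      Complex.mul_im, Complex.conj_re, Complex.conj_im]
    field_simp
    linear_combination (ρ x₀) * hcurl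
  set T : Fin d → ℝ := fun i => ∑ j, lam j * ‖w i j‖ ^ 2 with hT
  have hT0 : ∀ i, 0 ≤ T i := fun i =>
    Finset.sum_nonneg fun j _ => mul_nonneg (hlam j) (sq_nonneg _)
  have hbound : ρ x₀ * √(∑ i, ∑ k, Da i k ^ 2) ≤ ∑ i, T i := by
    have h := sqrt_sum_sq_le_sum_of_sq_le_mul (fun i k => ρ x₀ * Da i k) T hT0 fun i k => by
      rw [hDaw]
      exact weighted_gram_im_sq_le lam hlam (w i) (w k)
    simp only [mul_pow, ← Finset.mul_sum] at h
    rwa [Real.sqrt_mul (sq_nonneg _), Real.sqrt_sq hρpos.le] at h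
  have hTi : ∀ i, T i = ∑ j, lam j * ‖pderivC (φ j) x₀ i‖ ^ 2
      - ((z x₀ i).re ^ 2 + (z x₀ i).im ^ 2) / ρ x₀ := fun i =>
    weighted_norm_sq_sub_proj lam (fun j => φ j x₀) (fun j => pderivC (φ j) x₀ i) (ρ x₀) hρx
      hρpos.ne' (z x₀ i) rfl
  have hτT : (∑ i, pderivR ρ x₀ i ^ 2) / (4 * ρ x₀) + (∑ i, jp x₀ i ^ 2) / ρ x₀ + ∑ i, T i
      = τ := by
    have hτ' : τ = ∑ i, ∑ j, lam j * ‖pderivC (φ j) x₀ i‖ ^ 2 := by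
      rw [hτ, Finset.sum_comm]
      exact Finset.sum_congr rfl fun j _ => Finset.mul_sum _ _ _
    rw [hτ', Finset.sum_div, Finset.sum_div, ← Finset.sum_add_distrib, ← Finset.sum_add_distrib]
    refine Finset.sum_congr rfl fun i _ => ?_
    rw [hTi, hjz, pderivR, hρ'.fderiv, hpρ]
    field_simp
    ring
  have hd : 1 / √(d : ℝ) ≤ 1 := by
    rcases Nat.eq_zero_or_pos d with rfl | hd
    · simp
    · exact div_le_one_of_le₀ (Real.one_le_sqrt.2 (by exact_mod_cast hd)) (Real.sqrt_nonneg _)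
  have hnn : 0 ≤ ρ x₀ * √(∑ i, ∑ k, Da i k ^ 2) := by positivity
  rw [mul_assoc]
  linarith [mul_le_of_le_one_left hnn hd]
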